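/- The matrices Γ₁, …, Γ_L pairwise commute; their Riemannian mean, given (since they commute) by the product Γ₁^{1/L} · Γ₂^{1/L} ⋯ Γ_L^{1/L}, equals σ₀²·h₀h₀* + Σ_{j=1}^N c_j^R · h_j h_j* + v·I with c_j^R = ((σ_j²‖h_j‖² + v)^{τ_j} · v^{1−τ_j} − v)/‖h_j‖²; and their Euclidean mean (1/L)·Σ_{i=1}^L Γ_i equals σ₀²·h₀h₀* + Σ_{j=1}^N σ_j²τ_j · h_j h_j* + v·I. -/

import Mathlib

open Matrix Finset
open scoped ComplexOrder

noncomputable section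

/-- squared Euclidean norm of a complex vector. -/
def nsq {M : ℕ} (x : Fin M → ℂ) : ℝ := ∑ i, Complex.normSq (x i)

/-- outer product `x x*`. -/
def outerP {M : ℕ} (x : Fin M → ℂ) : Matrix (Fin M) (Fin M) ℂ :=
  Matrix.vecMulVec x (star x)

/-- `A ^ t` for a Hermitian matrix `A`, via the functional calculus applied to the
eigenvalues (junk value `0` if `A` is not Hermitian). -/
def mpow {n : ℕ} (A : Matrix (Fin n) (Fin n) ℂ) (t : ℝ) : Matrix (Fin n) (Fin n) ℂ :=
  if hA : A.IsHermitian then hA.cfc (fun x => x ^ t) else 0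

lemma nsq_pos_aux {M : ℕ} (x : Fin M → ℂ) (hx : x ≠ 0) : 0 < nsq x := by
  obtain ⟨i, hi⟩ := Function.ne_iff.mp hx
  exact Finset.sum_pos' (fun _ _ => Complex.normSq_nonneg _)
    ⟨i, Finset.mem_univ _, Complex.normSq_pos.mpr hi⟩

lemma star_dot_self_aux {M : ℕ} (x : Fin M → ℂ) : star x ⬝ᵥ x = ((nsq x : ℝ) : ℂ) := by
  simp [dotProduct, nsq, Complex.normSq_eq_conj_mul_self]

lemma outerP_mul_aux {M : ℕ} (x y : Fin M → ℂ) :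
    outerP x * outerP y = (star x ⬝ᵥ y) • Matrix.vecMulVec x (star y) := by
  simp [outerP, Matrix.vecMulVec_mul_vecMulVec, Matrix.vecMulVec_smul]

lemma outerP_herm_aux {M : ℕ} (x : Fin M → ℂ) : (outerP x).IsHermitian := by
  ext i j
  simp [outerP, Matrix.vecMulVec_apply, mul_comm]

/-- normalized projection -/
def projP {M : ℕ} (x : Fin M → ℂ) : Matrix (Fin M) (Fin M) ℂ := (nsq x)⁻¹ • outerP x

lemma projP_herm {M : ℕ} (x : Fin M → ℂ) : IsSelfAdjoint (projP x) := by
  unfold projP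
  exact (IsSelfAdjoint.all ((nsq x)⁻¹)).smul (outerP_herm_aux x)

lemma projP_orth {M K : ℕ} (h : Fin K → Fin M → ℂ) (hnz : ∀ r, h r ≠ 0)
    (horth : ∀ r s, r ≠ s → star (h r) ⬝ᵥ h s = 0) :
    OrthogonalIdempotents (fun r => projP (h r)) where
  idem r := by
    have hn := (nsq_pos_aux _ (hnz r)).ne'
    show projP (h r) * projP (h r) = projP (h r)
    simp only [projP, smul_mul_assoc, mul_smul_comm, outerP_mul_aux, star_dot_self_aux]
    rw [show Matrix.vecMulVec (h r) (star (h r)) = outerP (h r) from rfl, Complex.coe_smul,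
      inv_smul_smul₀ hn]
  ortho r s hrs := by
    show projP (h r) * projP (h s) = 0
    simp only [projP, smul_mul_assoc, mul_smul_comm, outerP_mul_aux, horth r s hrs, zero_smul,
      smul_zero]

/-- diagonal algebra map of a complete system -/
def diagHom {ι A : Type*} [Fintype ι] [DecidableEq ι] [Ring A] [Algebra ℝ A] (e : ι → A)
    (he : CompleteOrthogonalIdempotents e) : (ι → ℝ) →ₐ[ℝ] A :=
  AlgHom.ofLinearMap
    { toFun := fun f => ∑ i, f i • e i
      map_add' := fun f g => by simp [add_smul, Finset.sum_add_distrib]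
      map_smul' := fun c f => by simp [mul_smul, Finset.smul_sum] }
    (by simp [he.complete])
    (fun f g => by
      simp only [LinearMap.coe_mk, AddHom.coe_mk, Finset.sum_mul_sum, Pi.mul_apply]
      refine Finset.sum_congr rfl fun i _ => ?_
      rw [Finset.sum_eq_single i]
      · rw [smul_mul_smul_comm, (he.idem i).eq]
      · intro j _ hj
        rw [smul_mul_smul_comm, he.ortho hj.symm, smul_zero]
      · simp)

lemma diagHom_apply {ι A : Type*} [Fintype ι] [DecidableEq ι] [Ring A] [Algebra ℝ A] (e : ι → A)
    (he : CompleteOrthogonalIdempotents e) (f : ι → ℝ) :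
    diagHom e he f = ∑ i, f i • e i := rfl

lemma mpow_diag {ι : Type*} [Fintype ι] [DecidableEq ι] {M : ℕ}
    (e : ι → Matrix (Fin M) (Fin M) ℂ) (he : CompleteOrthogonalIdempotents e)
    (hs : ∀ i, IsSelfAdjoint (e i)) (f : ι → ℝ) (t : ℝ) :
    mpow (diagHom e he f) t = diagHom e he (fun i => f i ^ t) := by
  have hA : IsSelfAdjoint (diagHom e he f) := by
    rw [diagHom_apply]
    exact isSelfAdjoint_sum _ fun i _ => (IsSelfAdjoint.all (f i)).smul (hs i)
  have hA' : (diagHom e he f).IsHermitian := hA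
  rw [mpow, dif_pos hA', ← hA'.cfc_eq]
  have hfin : (spectrum ℝ (diagHom e he f)).Finite := Matrix.finite_real_spectrum
  let S : Finset ℝ := hfin.toFinset ∪ Finset.univ.image f
  let p : Polynomial ℝ := Lagrange.interpolate S id (fun x => x ^ t)
  have hp : ∀ x ∈ S, p.eval x = x ^ t := fun x hx =>
    Lagrange.eval_interpolate_at_node (v := id) (fun x => x ^ t) (Set.injOn_id _) hx
  rw [cfc_congr (g := p.eval) (fun x hx => (hp x (by simp [S, hx])).symm),
    cfc_polynomial p _ hA, Polynomial.aeval_algHom_apply]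
  congr 1
  ext i
  rw [← hp (f i) (by simp [S])]
  have := Polynomial.aeval_algHom_apply (Pi.evalAlgHom ℝ (fun _ : ι => ℝ) i) f p
  simpa [Polynomial.aeval_def, Polynomial.eval₂_eq_eval_map] using this.symm

lemma diag_repr {M N : ℕ} (h : Fin (N + 1) → Fin M → ℂ) (hnz : ∀ r, h r ≠ 0)
    (he : CompleteOrthogonalIdempotents (fun o : Option (Fin (N+1)) =>
      o.elim (1 - ∑ r, projP (h r)) (fun r => projP (h r))))
    (a0 : ℝ) (a : Fin N → ℝ) (v : ℝ) :
    a0 • outerP (h 0) + ∑ j : Fin N, a j • outerP (h j.succ)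
      + v • (1 : Matrix (Fin M) (Fin M) ℂ)
    = diagHom _ he (fun o => o.elim v
        (fun r => (Fin.cons a0 a : Fin (N+1) → ℝ) r * nsq (h r) + v)) := by
  have hn : ∀ r, (nsq (h r)) • projP (h r) = outerP (h r) := fun r =>
    smul_inv_smul₀ (nsq_pos_aux _ (hnz r)).ne' _
  rw [diagHom_apply, Fintype.sum_option]
  simp only [Option.elim, add_smul, mul_smul, hn, Finset.sum_add_distrib, ← Finset.smul_sum,
    smul_sub]
  rw [Fin.sum_univ_succ (fun r => (Fin.cons a0 a : Fin (N+1) → ℝ) r • outerP (h r))]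
  simp only [Fin.cons_zero, Fin.cons_succ]
  abel

lemma prod_ofFn_map_aux {A B : Type*} [CommSemiring A] [Semiring B] [Algebra ℝ A] [Algebra ℝ B]
    (φ : A →ₐ[ℝ] B) {L : ℕ} (g : Fin L → A) :
    (List.ofFn fun i => φ (g i)).prod = φ (∏ i, g i) := by
  rw [← List.prod_ofFn, map_list_prod, List.map_ofFn]
  rfl

/-- The segment correlation matrices `Γᵢ` pairwise commute; their
Riemannian mean `Γ₁^{1/L} ⋯ Γ_L^{1/L}` equals
`σ₀² h₀h₀* + ∑ⱼ c_j^R hⱼhⱼ* + v I` with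
`c_j^R = ((σⱼ²‖hⱼ‖² + v)^{τⱼ} v^{1-τⱼ} - v)/‖hⱼ‖²`, and their Euclidean mean
`(1/L) ∑ᵢ Γᵢ` equals `σ₀² h₀h₀* + ∑ⱼ σⱼ²τⱼ hⱼhⱼ* + v I`. -/
theorem riemannian_and_euclidean_mean_of_segment_correlations
    (M N L : ℕ) (hM : 1 ≤ M) (hN : 1 ≤ N) (hL : 1 ≤ L)
    (h : Fin (N + 1) → Fin M → ℂ)
    (hnz : ∀ r, h r ≠ 0)
    (horth : ∀ r s, r ≠ s → star (h r) ⬝ᵥ h s = 0)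
    (σ0sq : ℝ) (hσ0 : 0 < σ0sq)
    (σsq : Fin N → ℝ) (hσ : ∀ j, 0 < σsq j)
    (v : ℝ) (hv : 0 < v)
    (𝓛 : Fin N → Finset (Fin L))
    (τ : Fin N → ℝ) (hτ : ∀ j, τ j = ((𝓛 j).card : ℝ) / L)
    (Γ : Fin L → Matrix (Fin M) (Fin M) ℂ)
    (hΓ : ∀ i, Γ i = σ0sq • outerP (h 0)
        + ∑ j : Fin N, (if i ∈ 𝓛 j then σsq j else 0) • outerP (h j.succ)
        + v • (1 : Matrix (Fin M) (Fin M) ℂ)) :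
    (∀ i i', Commute (Γ i) (Γ i')) ∧
    (List.ofFn fun i => mpow (Γ i) ((L : ℝ)⁻¹)).prod
      = σ0sq • outerP (h 0)
        + ∑ j : Fin N,
            (((σsq j * nsq (h j.succ) + v) ^ (τ j) * v ^ (1 - τ j) - v)
              / nsq (h j.succ)) • outerP (h j.succ)
        + v • (1 : Matrix (Fin M) (Fin M) ℂ) ∧
    (L : ℝ)⁻¹ • ∑ i : Fin L, Γ i
      = σ0sq • outerP (h 0)
        + ∑ j : Fin N, (σsq j * τ j) • outerP (h j.succ)
        + v • (1 : Matrix (Fin M) (Fin M) ℂ) := by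
  have hL0 : (L : ℝ) ≠ 0 := by positivity
  have he := CompleteOrthogonalIdempotents.option (projP_orth h hnz horth)
  have hs : ∀ o : Option (Fin (N+1)), IsSelfAdjoint
      (o.elim (1 - ∑ r, projP (h r)) (fun r => projP (h r))) := by
    rintro (_ | r)
    · exact (IsSelfAdjoint.one _).sub (isSelfAdjoint_sum _ fun r _ => projP_herm _)
    · exact projP_herm _
  have hΓ' := fun i => (hΓ i).trans (diag_repr h hnz he _ _ _)
  refine ⟨fun i i' => ?_, ?_, ?_⟩
  · rw [hΓ' i, hΓ' i']
    exact (Commute.all _ _).map _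
  · rw [diag_repr h hnz he]
    simp only [hΓ', mpow_diag _ he hs]
    rw [prod_ofFn_map_aux]
    congr 1
    have key : ∀ x : ℝ, 0 < x → (x ^ (L : ℝ)⁻¹) ^ L = x := fun x hx =>
      Real.rpow_inv_natCast_pow hx.le (by omega)
    ext o
    rw [Finset.prod_apply]
    rcases o with _ | r
    · simp [key v hv]
    · have hnp := nsq_pos_aux _ (hnz r)
      refine Fin.cases ?_ (fun j => ?_) r
      · have := nsq_pos_aux _ (hnz 0)
        simp [key (σ0sq * nsq (h 0) + v) (by positivity)]
      · have hn := nsq_pos_aux _ (hnz j.succ)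
        have hσj := hσ j
        simp only [Option.elim, Fin.cons_succ]
        rw [div_mul_cancel₀ _ hn.ne', sub_add_cancel]
        have hx : 0 < σsq j * nsq (h j.succ) + v := by positivity
        have hterm : ∀ i : Fin L,
            ((if i ∈ 𝓛 j then σsq j else 0) * nsq (h j.succ) + v) ^ (L : ℝ)⁻¹
            = if i ∈ 𝓛 j then (σsq j * nsq (h j.succ) + v) ^ (L : ℝ)⁻¹ else v ^ (L : ℝ)⁻¹ := by
          intro i
          split_ifs <;> simp
        simp only [hterm]
        generalize σsq j * nsq (h j.succ) + v = x at hx ⊢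
        rw [Finset.prod_ite, Finset.prod_const, Finset.prod_const]
        have hc1 : (Finset.univ.filter fun i => i ∈ 𝓛 j) = 𝓛 j := by ext; simp
        have hc2 : (Finset.univ.filter fun i => ¬ i ∈ 𝓛 j) = (𝓛 j)ᶜ := by ext; simp
        have hle : (𝓛 j).card ≤ L := by simpa using Finset.card_le_univ (𝓛 j)
        rw [hc1, hc2, Finset.card_compl, Fintype.card_fin, hτ,
          ← Real.rpow_mul_natCast hx.le, ← Real.rpow_mul_natCast hv.le, Nat.cast_sub hle]
        congr 2
        · field_simp
        · field_simp
  · simp only [hΓ, Finset.sum_add_distrib, smul_add]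
    rw [Finset.sum_comm]
    simp only [← Finset.sum_smul]
    simp only [Finset.sum_const, Finset.card_univ, Fintype.card_fin, Finset.smul_sum, smul_smul,
      ← Nat.cast_smul_eq_nsmul ℝ, inv_mul_cancel₀ hL0, one_smul, inv_mul_cancel_left₀ hL0, smul_eq_mul]
    congr 2
    refine Finset.sum_congr rfl fun j _ => ?_
    congr 1
    rw [hτ, Finset.sum_ite_mem]
    simp
    field_simp
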